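/- Fix d ≥ 2, N ≥ 1, M ≥ 1. Let S ∈ ℝ^{M×s_d(N)} with columns indexed by words of length at most N, let 0 ≤ C_0 ≤ C_1 ≤ ⋯ ≤ C_N be real constants, and define the penalty Ω(θ) = Σ_{k=0}^N (C_k/(k!√M)) ‖θ_{[k]}‖_1 for θ ∈ ℝ^{s_d(N)}. Let y ∈ ℝ^M and ε ∈ ℝ^M satisfy ‖ε^⊤ S_{[k]}‖_∞ ≤ (√M) C_k / k! for every k = 0,…,N, and set Y = y + ε. Let Λ_0,…,Λ_N ≥ 0 and let θ* ∈ ℝ^{s_d(N)} satisfy ‖θ*_{[k]}‖_1 ≤ d^k Λ_k for every k = 0,…,N. Then any minimizer θ̂ over ℝ^{s_d(N)} of θ ↦ (1/(2M))‖Y − Sθ‖² + Ω(θ) satisfies (1/(2M))‖y − S θ̂‖² ≤ (1/(2M))‖y − S θ*‖² + (2 C_N/√M) Σ_{k=0}^N d^k Λ_k / k!. -/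

import Mathlib

open Nat

/-!
STATEMENT 1: Deterministic core of the estimation-error lemma.  Coordinates of `ℝ^{s_d(N)}` are
indexed by words of length at most `N` over `{1,…,d}`, encoded as the sigma type
`(k : Fin (N+1)) × (Fin k → Fin d)`; `θ_{[k]}` is the subvector indexed by words of length `k`.
With penalty `Ω(θ) = Σ_k (C_k/(k!√M)) ‖θ_{[k]}‖₁`, noise correlations
`‖ε^⊤S_{[k]}‖_∞ ≤ √M C_k / k!`, and `‖θ*_{[k]}‖₁ ≤ d^k Λ_k`, any minimizer `θ̂` of
`θ ↦ (1/(2M))‖Y − Sθ‖² + Ω(θ)` (with `Y = y + ε`) satisfies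
`(1/(2M))‖y − Sθ̂‖² ≤ (1/(2M))‖y − Sθ*‖² + (2 C_N/√M) Σ_k d^k Λ_k / k!`.
-/

theorem estimation_error_deterministic_core
    (d N M : ℕ) (hd : 2 ≤ d) (hN : 1 ≤ N) (hM : 1 ≤ M)
    (S : Matrix (Fin M) ((k : Fin (N + 1)) × (Fin (k : ℕ) → Fin d)) ℝ)
    (C : Fin (N + 1) → ℝ) (hC0 : 0 ≤ C 0) (hCmono : Monotone C)
    (y ε : Fin M → ℝ)
    (hcorr : ∀ (k : Fin (N + 1)) (w : Fin (k : ℕ) → Fin d),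
      |∑ i, ε i * S i ⟨k, w⟩| ≤ Real.sqrt M * C k / ((k : ℕ)! : ℝ))
    (Λ : Fin (N + 1) → ℝ) (hΛ : ∀ k, 0 ≤ Λ k)
    (θstar : ((k : Fin (N + 1)) × (Fin (k : ℕ) → Fin d)) → ℝ)
    (hθstar : ∀ k : Fin (N + 1),
      ∑ w : Fin (k : ℕ) → Fin d, |θstar ⟨k, w⟩| ≤ (d : ℝ) ^ (k : ℕ) * Λ k)
    (θhat : ((k : Fin (N + 1)) × (Fin (k : ℕ) → Fin d)) → ℝ)
    (hmin : ∀ θ : ((k : Fin (N + 1)) × (Fin (k : ℕ) → Fin d)) → ℝ,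
      (1 / (2 * (M : ℝ))) * ∑ i, ((y i + ε i) - ∑ q, S i q * θhat q) ^ 2 +
          ∑ k : Fin (N + 1),
            (C k / (((k : ℕ)! : ℝ) * Real.sqrt M)) * ∑ w : Fin (k : ℕ) → Fin d, |θhat ⟨k, w⟩| ≤
        (1 / (2 * (M : ℝ))) * ∑ i, ((y i + ε i) - ∑ q, S i q * θ q) ^ 2 +
          ∑ k : Fin (N + 1),
            (C k / (((k : ℕ)! : ℝ) * Real.sqrt M)) * ∑ w : Fin (k : ℕ) → Fin d, |θ ⟨k, w⟩|) :
    (1 / (2 * (M : ℝ))) * ∑ i, (y i - ∑ q, S i q * θhat q) ^ 2 ≤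
      (1 / (2 * (M : ℝ))) * ∑ i, (y i - ∑ q, S i q * θstar q) ^ 2 +
        (2 * C (Fin.last N) / Real.sqrt M) *
          ∑ k : Fin (N + 1), (d : ℝ) ^ (k : ℕ) * Λ k / ((k : ℕ)! : ℝ) := by
  have hMpos : (0 : ℝ) < M := by exact_mod_cast hM
  have hsq : 0 < Real.sqrt M := Real.sqrt_pos.mpr hMpos
  have hss : Real.sqrt M * Real.sqrt M = M := Real.mul_self_sqrt hMpos.le
  have hfac : ∀ k : Fin (N + 1), (0 : ℝ) < ((k : ℕ)! : ℝ) := fun k => by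
    exact_mod_cast Nat.factorial_pos _
  have key : ∀ θ : ((k : Fin (N + 1)) × (Fin (k : ℕ) → Fin d)) → ℝ,
      |∑ i, ε i * ∑ q, S i q * θ q| ≤ M * ∑ k : Fin (N + 1),
        (C k / (((k : ℕ)! : ℝ) * Real.sqrt M)) * ∑ w : Fin (k : ℕ) → Fin d, |θ ⟨k, w⟩| := by
    intro θ
    have e1 : ∑ i, ε i * ∑ q, S i q * θ q = ∑ q, (∑ i, ε i * S i q) * θ q := by
      simp_rw [Finset.mul_sum, Finset.sum_mul]
      rw [Finset.sum_comm]
      simp_rw [mul_assoc]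
    rw [e1]
    refine (Finset.abs_sum_le_sum_abs _ _).trans ?_
    rw [Fintype.sum_sigma, Finset.mul_sum]
    refine Finset.sum_le_sum fun k _ => ?_
    rw [Finset.mul_sum, Finset.mul_sum]
    refine Finset.sum_le_sum fun w _ => ?_
    rw [abs_mul, ← mul_assoc]
    refine mul_le_mul_of_nonneg_right ((hcorr k w).trans (le_of_eq ?_)) (abs_nonneg _)
    have := hfac k
    rw [← mul_div_assoc, div_eq_div_iff (by positivity) (by positivity)]
    linear_combination (C k * ((k : ℕ)! : ℝ)) * hss
  have expand : ∀ a : Fin M → ℝ, ∑ i, ((y i + ε i) - a i) ^ 2 =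
      ∑ i, (y i - a i) ^ 2 + ∑ i, (2 * ε i * y i + ε i ^ 2) - 2 * ∑ i, ε i * a i := by
    intro a
    rw [Finset.mul_sum, ← Finset.sum_add_distrib, ← Finset.sum_sub_distrib]
    exact Finset.sum_congr rfl fun i _ => by ring
  have h := hmin θstar
  rw [expand (fun i => ∑ q, S i q * θhat q), expand (fun i => ∑ q, S i q * θstar q)] at h
  have k1 := (abs_le.mp (key θhat)).2
  have k2 := (abs_le.mp (key θstar)).1
  have hΩ : ∑ k : Fin (N + 1), (C k / (((k : ℕ)! : ℝ) * Real.sqrt M)) *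
      ∑ w : Fin (k : ℕ) → Fin d, |θstar ⟨k, w⟩| ≤
      (C (Fin.last N) / Real.sqrt M) *
          ∑ k : Fin (N + 1), (d : ℝ) ^ (k : ℕ) * Λ k / ((k : ℕ)! : ℝ) := by
    rw [Finset.mul_sum]
    refine Finset.sum_le_sum fun k _ => ?_
    have hf := hfac k
    have hCk : 0 ≤ C k := hC0.trans (hCmono (Fin.zero_le k))
    have hCl : C k ≤ C (Fin.last N) := hCmono (Fin.le_last k)
    have hL := hΛ k
    calc _ ≤ (C (Fin.last N) / (((k : ℕ)! : ℝ) * Real.sqrt M)) * ((d : ℝ) ^ (k : ℕ) * Λ k) :=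
          mul_le_mul (by gcongr) (hθstar k) (Finset.sum_nonneg fun _ _ => abs_nonneg _)
            (div_nonneg (hCk.trans hCl) (by positivity))
      _ = _ := by field_simp
  rw [mul_div_assoc, mul_assoc]
  generalize (∑ k : Fin (N + 1), (C k / (((k : ℕ)! : ℝ) * Real.sqrt M)) *
      ∑ w : Fin (k : ℕ) → Fin d, |θstar ⟨k, w⟩|) = A at *
  generalize (∑ k : Fin (N + 1), (C k / (((k : ℕ)! : ℝ) * Real.sqrt M)) *
      ∑ w : Fin (k : ℕ) → Fin d, |θhat ⟨k, w⟩|) = B at *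
  generalize (∑ i, ε i * ∑ q, S i q * θhat q) = a at *
  generalize (∑ i, ε i * ∑ q, S i q * θstar q) = b at *
  have e3 : (1 / (2 * (M : ℝ))) * (2 * a - 2 * b) ≤ A + B := by
    rw [one_div, inv_mul_le_iff₀ (by positivity)]
    linarith
  linarith
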